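/- Let X_1,…,X_K be mutually independent finitely-valued random variables and let (X_1,…,X_K,Y,Z) be jointly distributed. Let 𝒦′ ⊆ 𝒦 and write 𝒦̄′ = 𝒦∖𝒦′. Assume that I(X_S;Y|X_{𝒦∖S}) − I(X_S;Z|X_{𝒦̄′}) ≥ 0 for every S ⊆ 𝒦′. Then for every tuple of nonnegative reals (R_1^s,R_1^o,…,R_K^s,R_K^o) with R_k^s = 0 for all k ∈ 𝒦̄′ which satisfies, for all S ⊆ 𝒦′, S′ ⊆ S and T ⊆ 𝒦̄′, ∑_{k∈S} R_k^s + ∑_{k∈S∖S′} R_k^o + ∑_{k∈T} R_k^o ≤ I(X_{S∪T};Y|X_{𝒦∖(S∪T)}) − I(X_{S′};Z|X_{𝒦̄′}), there exist reals R_k^a ≥ 0 for k ∈ 𝒦′ such that: (i) for all S ⊆ 𝒦′ and T ⊆ 𝒦̄′, ∑_{k∈S}(R_k^s+R_k^o+R_k^a) + ∑_{k∈T} R_k^o ≤ I(X_{S∪T};Y|X_{𝒦∖(S∪T)}); and (ii) for all S ⊆ 𝒦′, ∑_{k∈S}(R_k^o+R_k^a) ≥ I(X_S;Z|X_{𝒦̄′}).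 -/

import Mathlib

open scoped Classical

noncomputable section

/-- Probability that random variable `X` takes value `x`, under pmf `p` on a finite sample space. -/
def probOf {Ω α : Type} [Fintype Ω] (p : Ω → ℝ) (X : Ω → α) (x : α) : ℝ :=
  ∑ ω, if X ω = x then p ω else 0

/-- Shannon entropy of a finitely-valued random variable. -/
def Hent {Ω α : Type} [Fintype Ω] [Fintype α] (p : Ω → ℝ) (X : Ω → α) : ℝ :=
  -∑ x, probOf p X x * Real.log (probOf p X x)

/-- Conditional entropy `H(X | C)`. -/
def condHent {Ω α γ : Type} [Fintype Ω] [Fintype α] [Fintype γ]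
    (p : Ω → ℝ) (X : Ω → α) (C : Ω → γ) : ℝ :=
  Hent p (fun ω => (X ω, C ω)) - Hent p C

/-- Conditional mutual information `I(A;B | C)`. -/
def IcondMut {Ω α β γ : Type} [Fintype Ω] [Fintype α] [Fintype β] [Fintype γ]
    (p : Ω → ℝ) (A : Ω → α) (B : Ω → β) (C : Ω → γ) : ℝ :=
  condHent p A C + condHent p B C - condHent p (fun ω => (A ω, B ω)) C

/-- Mutual information `I(A;B)`. -/
def Imut {Ω α β : Type} [Fintype Ω] [Fintype α] [Fintype β]
    (p : Ω → ℝ) (A : Ω → α) (B : Ω → β) : ℝ :=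
  Hent p A + Hent p B - Hent p (fun ω => (A ω, B ω))

/-- `p` is a probability mass function. -/
def IsPMF {Ω : Type} [Fintype Ω] (p : Ω → ℝ) : Prop :=
  (∀ ω, 0 ≤ p ω) ∧ ∑ ω, p ω = 1

/-- The tuple `X_S = (X_k)_{k ∈ S}` as a random variable. -/
def tup {Ω ι : Type} {𝒳 : ι → Type} (X : ∀ k, Ω → 𝒳 k) (S : Finset ι) :
    Ω → ∀ k : S, 𝒳 k.1 :=
  fun ω k => X k.1 ω

/-- The random variables `X_1, …, X_K` are mutually independent. -/
def MutIndep {Ω ι : Type} [Fintype Ω] [Fintype ι] {𝒳 : ι → Type} [∀ k, Fintype (𝒳 k)]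
    (p : Ω → ℝ) (X : ∀ k, Ω → 𝒳 k) : Prop :=
  ∀ x : ∀ k, 𝒳 k, probOf p (fun ω k => X k ω) x = ∏ k, probOf p (X k) (x k)

/-! ### Entropy of finitely-valued random variables -/

lemma probOf_nonneg {Ω α : Type} [Fintype Ω] {p : Ω → ℝ} (hp : ∀ ω, 0 ≤ p ω) (X : Ω → α) (x : α) :
    0 ≤ probOf p X x :=
  Finset.sum_nonneg fun ω _ => by split_ifs; exacts [hp ω, le_rfl]

lemma probOf_self_pos {Ω α : Type} [Fintype Ω] {p : Ω → ℝ} (hp : ∀ ω, 0 ≤ p ω) (X : Ω → α) {ω : Ω}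
    (hω : 0 < p ω) : 0 < probOf p X (X ω) := by
  refine hω.trans_le ?_
  have h := Finset.single_le_sum (f := fun ω' => if X ω' = X ω then p ω' else 0)
    (fun ω' _ => by split_ifs; exacts [hp ω', le_rfl]) (Finset.mem_univ ω)
  simpa [probOf] using h

lemma sum_mul_comp_eq_sum_probOf {Ω α : Type} [Fintype Ω] [Fintype α] (p : Ω → ℝ) (X : Ω → α)
    (φ : α → ℝ) : ∑ ω, p ω * φ (X ω) = ∑ x, probOf p X x * φ x := by
  simp only [probOf, Finset.sum_mul]
  rw [Finset.sum_comm]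
  refine Finset.sum_congr rfl fun ω _ => ?_
  simp

lemma sum_probOf {Ω α : Type} [Fintype Ω] [Fintype α] (p : Ω → ℝ) (X : Ω → α) :
    ∑ x, probOf p X x = ∑ ω, p ω := by
  simpa using (sum_mul_comp_eq_sum_probOf p X fun _ => 1).symm

lemma sum_probOf_prodMk {Ω α γ : Type} [Fintype Ω] [Fintype α] (p : Ω → ℝ) (A : Ω → α) (C : Ω → γ)
    (c : γ) : ∑ a, probOf p (fun ω => (A ω, C ω)) (a, c) = probOf p C c := by
  simp only [probOf]
  rw [Finset.sum_comm]
  refine Finset.sum_congr rfl fun ω _ => ?_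
  by_cases h : C ω = c <;> simp [h]

lemma Hent_eq_sum {Ω α : Type} [Fintype Ω] [Fintype α] (p : Ω → ℝ) (X : Ω → α) :
    Hent p X = -∑ ω, p ω * Real.log (probOf p X (X ω)) := by
  rw [Hent, sum_mul_comp_eq_sum_probOf p X fun x => Real.log (probOf p X x)]

lemma Hent_congr {Ω α β : Type} [Fintype Ω] [Fintype α] [Fintype β] (p : Ω → ℝ) {X : Ω → α}
    {Y : Ω → β} (h : ∀ ω ω', X ω = X ω' ↔ Y ω = Y ω') : Hent p X = Hent p Y := by
  simp only [Hent_eq_sum, probOf, h]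

lemma Hent_eq_zero {Ω α : Type} [Fintype Ω] [Fintype α] {p : Ω → ℝ} (hp : IsPMF p) {X : Ω → α}
    (h : ∀ ω ω', X ω = X ω') : Hent p X = 0 := by
  rw [Hent_eq_sum]
  have hX : ∀ ω, probOf p X (X ω) = 1 := fun ω => by
    simp [probOf, h _ ω, hp.2]
  simp [hX]

lemma sum_probOf_mul_probOf_div_le {Ω α β γ : Type} [Fintype Ω] [Fintype α] [Fintype β] [Fintype γ]
    {p : Ω → ℝ} (hp : IsPMF p) (A : Ω → α) (B : Ω → β) (C : Ω → γ) :
    ∑ x : α × β × γ, probOf p (fun ω => (A ω, C ω)) (x.1, x.2.2) *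
      probOf p (fun ω => (B ω, C ω)) (x.2.1, x.2.2) / probOf p C x.2.2 ≤ 1 := by
  rw [Fintype.sum_prod_type_right, Fintype.sum_prod_type_right]
  have h : ∀ c, ∑ b, ∑ a, probOf p (fun ω => (A ω, C ω)) (a, c) *
      probOf p (fun ω => (B ω, C ω)) (b, c) / probOf p C c = probOf p C c := fun c => by
    simp only [← Finset.sum_div, ← Finset.sum_mul, ← Finset.mul_sum, sum_probOf_prodMk]
    exact mul_self_div_self _
  simp only [h, sum_probOf, hp.2, le_refl]

/-- Nonnegativity of conditional mutual information. -/
lemma Hent_prodMk_add_le {Ω α β γ : Type} [Fintype Ω] [Fintype α] [Fintype β] [Fintype γ]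
    {p : Ω → ℝ} (hp : IsPMF p) (A : Ω → α) (B : Ω → β) (C : Ω → γ) :
    Hent p (fun ω => (A ω, B ω, C ω)) + Hent p C ≤
      Hent p (fun ω => (A ω, C ω)) + Hent p (fun ω => (B ω, C ω)) := by
  set pAC := probOf p (fun ω => (A ω, C ω)) with hAC
  set pBC := probOf p (fun ω => (B ω, C ω)) with hBC
  set pJ := probOf p (fun ω => (A ω, B ω, C ω)) with hJ
  set pC := probOf p C with hC
  let r : α × β × γ → ℝ := fun x => pAC (x.1, x.2.2) * pBC (x.2.1, x.2.2) / pC x.2.2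
  have hr : ∀ x, 0 ≤ r x := fun x => div_nonneg
    (mul_nonneg (probOf_nonneg hp.1 _ _) (probOf_nonneg hp.1 _ _)) (probOf_nonneg hp.1 _ _)
  have hpt : ∀ ω, p ω * (Real.log (pAC (A ω, C ω)) + Real.log (pBC (B ω, C ω)) -
      Real.log (pJ (A ω, B ω, C ω)) - Real.log (pC (C ω))) ≤
      p ω * (r (A ω, B ω, C ω) / pJ (A ω, B ω, C ω)) - p ω := fun ω => by
    rcases (hp.1 ω).eq_or_lt with h0 | hω
    · simp [← h0]
    have h1 : 0 < pAC (A ω, C ω) := probOf_self_pos hp.1 (fun ω => (A ω, C ω)) hω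
    have h2 : 0 < pBC (B ω, C ω) := probOf_self_pos hp.1 (fun ω => (B ω, C ω)) hω
    have h3 : 0 < pJ (A ω, B ω, C ω) := probOf_self_pos hp.1 (fun ω => (A ω, B ω, C ω)) hω
    have h4 : 0 < pC (C ω) := probOf_self_pos hp.1 C hω
    have hlog := Real.log_le_sub_one_of_pos (div_pos (div_pos (mul_pos h1 h2) h4) h3)
    rw [Real.log_div (div_pos (mul_pos h1 h2) h4).ne' h3.ne',
      Real.log_div (mul_pos h1 h2).ne' h4.ne', Real.log_mul h1.ne' h2.ne'] at hlog
    have := mul_le_mul_of_nonneg_left hlog hω.le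
    simp only [r]
    linarith
  have hsum := Finset.sum_le_sum fun ω (_ : ω ∈ Finset.univ) => hpt ω
  have hle : ∑ ω, p ω * (r (A ω, B ω, C ω) / pJ (A ω, B ω, C ω)) ≤ 1 := by
    rw [sum_mul_comp_eq_sum_probOf p (fun ω => (A ω, B ω, C ω)) fun x => r x / pJ x]
    refine (Finset.sum_le_sum fun x _ => ?_).trans (sum_probOf_mul_probOf_div_le hp A B C)
    change pJ x * (r x / pJ x) ≤ r x
    rcases eq_or_ne (pJ x) 0 with h | h
    · simpa [h] using hr x
    · rw [mul_div_cancel₀ _ h]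
  simp only [Finset.sum_sub_distrib, mul_sub, mul_add, Finset.sum_add_distrib, hp.2] at hsum
  simp only [Hent_eq_sum]
  linarith

/-- Submodularity of entropy: `J` carries the same information as the pair `(U, V)`, and `M` is a
function of `U` as well as of `V`. -/
lemma Hent_add_le {Ω α β γ δ : Type} [Fintype Ω] [Fintype α] [Fintype β] [Fintype γ] [Fintype δ]
    {p : Ω → ℝ} (hp : IsPMF p) {U : Ω → α} {V : Ω → β} {M : Ω → γ} {J : Ω → δ}
    (hJ : ∀ ω ω', J ω = J ω' ↔ U ω = U ω' ∧ V ω = V ω')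
    (hMU : ∀ ω ω', U ω = U ω' → M ω = M ω') (hMV : ∀ ω ω', V ω = V ω' → M ω = M ω') :
    Hent p J + Hent p M ≤ Hent p U + Hent p V := by
  have h := Hent_prodMk_add_le hp U V M
  rwa [Hent_congr p (X := fun ω => (U ω, V ω, M ω)) (Y := J) (by grind),
    Hent_congr p (X := fun ω => (U ω, M ω)) (Y := U) (by grind),
    Hent_congr p (X := fun ω => (V ω, M ω)) (Y := V) (by grind)] at h

/-! ### Entropies of tuples -/

lemma tup_eq_iff {Ω ι : Type} {𝒳 : ι → Type} (X : ∀ k, Ω → 𝒳 k) (S : Finset ι) (ω ω' : Ω) :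
    tup X S ω = tup X S ω' ↔ ∀ k ∈ S, X k ω = X k ω' := by
  simp [tup, funext_iff]

section Tuples

variable {Ω ι : Type} [Fintype Ω] [DecidableEq ι] {𝒳 : ι → Type}
  [∀ k, Fintype (𝒳 k)] {p : Ω → ℝ}

lemma Hent_tup_submodular (hp : IsPMF p) (X : ∀ k, Ω → 𝒳 k) (S T : Finset ι) :
    Hent p (tup X (S ∪ T)) + Hent p (tup X (S ∩ T)) ≤ Hent p (tup X S) + Hent p (tup X T) := by
  apply Hent_add_le hp <;> simp only [tup_eq_iff] <;> grind

lemma Hent_prodMk_tup_submodular {β : Type} [Fintype β] (hp : IsPMF p) (X : ∀ k, Ω → 𝒳 k)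
    (W : Ω → β) (S T : Finset ι) :
    Hent p (fun ω => (W ω, tup X (S ∪ T) ω)) + Hent p (fun ω => (W ω, tup X (S ∩ T) ω)) ≤
      Hent p (fun ω => (W ω, tup X S ω)) + Hent p (fun ω => (W ω, tup X T ω)) := by
  apply Hent_add_le hp <;> simp only [Prod.mk.injEq, tup_eq_iff] <;> grind

lemma Hent_tup_empty (hp : IsPMF p) (X : ∀ k, Ω → 𝒳 k) : Hent p (tup X ∅) = 0 :=
  Hent_eq_zero hp (by simp [tup_eq_iff])

lemma Hent_tup_le_sum (hp : IsPMF p) (X : ∀ k, Ω → 𝒳 k) (S : Finset ι) :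
    Hent p (tup X S) ≤ ∑ k ∈ S, Hent p (X k) := by
  induction S using Finset.induction_on with
  | empty => simp [Hent_tup_empty hp]
  | insert a S ha ih =>
    rw [Finset.sum_insert ha]
    have h : Hent p (tup X (insert a S)) + Hent p (tup X ∅) ≤ Hent p (X a) + Hent p (tup X S) := by
      apply Hent_add_le hp <;> simp [tup_eq_iff]
    rw [Hent_tup_empty hp] at h
    linarith

lemma MutIndep.Hent_tup_univ [Fintype ι] {X : ∀ k, Ω → 𝒳 k} (hp : IsPMF p) (hind : MutIndep p X) :
    Hent p (tup X Finset.univ) = ∑ k, Hent p (X k) := by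
  rw [Hent_congr p (Y := fun ω k => X k ω) fun ω ω' => by rw [tup_eq_iff, funext_iff]; simp]
  simp only [Hent_eq_sum]
  rw [Finset.sum_neg_distrib, Finset.sum_comm]
  congr 1
  refine Finset.sum_congr rfl fun ω _ => ?_
  rcases (hp.1 ω).eq_or_lt with h0 | hω
  · simp [← h0]
  rw [hind, Real.log_prod fun k _ => (probOf_self_pos hp.1 (X k) hω).ne', Finset.mul_sum]

lemma MutIndep.Hent_tup [Fintype ι] {X : ∀ k, Ω → 𝒳 k} (hp : IsPMF p) (hind : MutIndep p X)
    (S : Finset ι) : Hent p (tup X S) = ∑ k ∈ S, Hent p (X k) := by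
  refine (Hent_tup_le_sum hp X S).antisymm ?_
  have h := Hent_tup_submodular hp X S Sᶜ
  rw [Finset.union_compl, Finset.inter_compl, Hent_tup_empty hp, hind.Hent_tup_univ hp] at h
  have hc := Hent_tup_le_sum hp X Sᶜ
  have := Finset.sum_add_sum_compl S fun k => Hent p (X k)
  linarith

lemma MutIndep.Hent_tup_modular [Fintype ι] {X : ∀ k, Ω → 𝒳 k} (hp : IsPMF p) (hind : MutIndep p X)
    (S T : Finset ι) :
    Hent p (tup X (S ∪ T)) + Hent p (tup X (S ∩ T)) = Hent p (tup X S) + Hent p (tup X T) := by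
  simp only [hind.Hent_tup hp, Finset.sum_union_inter]

lemma IcondMut_tup {β : Type} [Fintype β] (X : ∀ k, Ω → 𝒳 k) (W : Ω → β) (S C : Finset ι) :
    IcondMut p (tup X S) W (tup X C) =
      Hent p (tup X (S ∪ C)) - Hent p (tup X C) + Hent p (fun ω => (W ω, tup X C ω)) -
        Hent p (fun ω => (W ω, tup X (S ∪ C) ω)) := by
  rw [IcondMut, condHent, condHent, condHent,
    Hent_congr p (X := fun ω => (tup X S ω, tup X C ω)) (Y := tup X (S ∪ C))
      (by simp only [Prod.mk.injEq, tup_eq_iff]; grind),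
    Hent_congr p (X := fun ω => ((tup X S ω, W ω), tup X C ω))
      (Y := fun ω => (W ω, tup X (S ∪ C) ω))
      (by simp only [Prod.mk.injEq, tup_eq_iff]; grind)]
  ring

lemma IcondMut_tup_empty {β : Type} [Fintype β] (X : ∀ k, Ω → 𝒳 k) (W : Ω → β) (C : Finset ι) :
    IcondMut p (tup X ∅) W (tup X C) = 0 := by
  rw [IcondMut_tup, Finset.empty_union]
  ring

lemma MutIndep.IcondMut_tup_compl_submodular [Fintype ι] {β : Type} [Fintype β] {X : ∀ k, Ω → 𝒳 k}
    (hp : IsPMF p) (hind : MutIndep p X) (W : Ω → β) (S T : Finset ι) :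
    IcondMut p (tup X (S ∪ T)) W (tup X (Finset.univ \ (S ∪ T))) +
        IcondMut p (tup X (S ∩ T)) W (tup X (Finset.univ \ (S ∩ T))) ≤
      IcondMut p (tup X S) W (tup X (Finset.univ \ S)) +
        IcondMut p (tup X T) W (tup X (Finset.univ \ T)) := by
  have hU : ∀ U : Finset ι, IcondMut p (tup X U) W (tup X (Finset.univ \ U)) =
      Hent p (tup X Finset.univ) - Hent p (tup X (Finset.univ \ U)) +
        Hent p (fun ω => (W ω, tup X (Finset.univ \ U) ω)) -
          Hent p (fun ω => (W ω, tup X Finset.univ ω)) := fun U => by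
    rw [IcondMut_tup, Finset.union_sdiff_of_subset (Finset.subset_univ U)]
  have h1 := hind.Hent_tup_modular hp (Finset.univ \ S) (Finset.univ \ T)
  have h2 := Hent_prodMk_tup_submodular hp X W (Finset.univ \ S) (Finset.univ \ T)
  rw [← Finset.sdiff_inter_distrib_right, ← Finset.sdiff_union_distrib] at h1 h2
  rw [hU, hU, hU, hU]
  linarith

lemma MutIndep.IcondMut_tup_supermodular [Fintype ι] {β : Type} [Fintype β] {X : ∀ k, Ω → 𝒳 k}
    (hp : IsPMF p) (hind : MutIndep p X) (W : Ω → β) (C S T : Finset ι) :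
    IcondMut p (tup X S) W (tup X C) + IcondMut p (tup X T) W (tup X C) ≤
      IcondMut p (tup X (S ∪ T)) W (tup X C) + IcondMut p (tup X (S ∩ T)) W (tup X C) := by
  have h1 := hind.Hent_tup_modular hp (S ∪ C) (T ∪ C)
  have h2 := Hent_prodMk_tup_submodular hp X W (S ∪ C) (T ∪ C)
  rw [← Finset.union_union_distrib_right, ← Finset.inter_union_distrib_right] at h1 h2
  simp only [IcondMut_tup]
  linarith

end Tuples

/-! ### The sandwich theorem for submodular functions -/

/-- Frank's sandwich theorem: a modular function separates a supermodular function from a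
submodular function above it. -/
lemma exists_sum_between_of_supermodular_of_submodular {ι : Type} [DecidableEq ι] (V : Finset ι)
    (F G : Finset ι → ℝ) (hF0 : F ∅ = 0) (hG0 : G ∅ = 0)
    (hF : ∀ S ⊆ V, ∀ T ⊆ V, F (S ∪ T) + F (S ∩ T) ≤ F S + F T)
    (hG : ∀ S ⊆ V, ∀ T ⊆ V, G S + G T ≤ G (S ∪ T) + G (S ∩ T))
    (hGF : ∀ S ⊆ V, G S ≤ F S) :
    ∃ x : ι → ℝ, ∀ S ⊆ V, G S ≤ ∑ k ∈ S, x k ∧ ∑ k ∈ S, x k ≤ F S := by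
  induction V using Finset.induction_on generalizing F G with
  | empty =>
    refine ⟨0, fun S hS => ?_⟩
    simp [Finset.subset_empty.1 hS, hF0, hG0]
  | insert e V he ih =>
    have hcross : ∀ S ∈ V.powerset, ∀ T ∈ V.powerset,
        G (insert e S) - F S ≤ F (insert e T) - G T := fun S hS T hT => by
      rw [Finset.mem_powerset] at hS hT
      have heS : e ∉ S := fun h => he (hS h)
      have heT : e ∉ T := fun h => he (hT h)
      have h1 := hG (insert e S) (Finset.insert_subset_insert e hS) T
        (hT.trans (Finset.subset_insert e V))
      have h2 := hF S (hS.trans (Finset.subset_insert e V)) (insert e T)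
        (Finset.insert_subset_insert e hT)
      rw [Finset.insert_union, Finset.insert_inter_of_notMem heT] at h1
      rw [Finset.union_insert, Finset.inter_insert_of_notMem heS] at h2
      have h3 := hGF (insert e (S ∪ T))
        (Finset.insert_subset_insert e (Finset.union_subset hS hT))
      have h4 := hGF (S ∩ T) (Finset.inter_subset_left.trans (hS.trans (Finset.subset_insert e V)))
      linarith
    obtain ⟨y, hylow, hyup⟩ : ∃ y : ℝ, (∀ S ⊆ V, G (insert e S) - F S ≤ y) ∧
        ∀ T ⊆ V, y ≤ F (insert e T) - G T := by
      have hne : V.powerset.Nonempty := ⟨∅, Finset.empty_mem_powerset V⟩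
      refine ⟨V.powerset.sup' hne fun S => G (insert e S) - F S, fun S hS => ?_, fun T hT => ?_⟩
      · exact Finset.le_sup' (fun S => G (insert e S) - F S) (Finset.mem_powerset.2 hS)
      · exact Finset.sup'_le _ _ fun S hS => hcross S hS T (Finset.mem_powerset.2 hT)
    have hyF := hyup ∅ (Finset.empty_subset V)
    have hyG := hylow ∅ (Finset.empty_subset V)
    rw [hG0] at hyF
    rw [hF0] at hyG
    obtain ⟨x, hx⟩ := ih (fun S => min (F S) (F (insert e S) - y))
      (fun S => max (G S) (G (insert e S) - y))
      (by rw [hF0]; exact min_eq_left (by linarith))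
      (by rw [hG0]; exact max_eq_left (by linarith))
      (fun S hS T hT => by
        have hS' := hS.trans (Finset.subset_insert e V)
        have hT' := hT.trans (Finset.subset_insert e V)
        have heS : e ∉ S := fun h => he (hS h)
        have heT : e ∉ T := fun h => he (hT h)
        have hSi := Finset.insert_subset_insert e hS
        have hTi := Finset.insert_subset_insert e hT
        have h1 := hF S hS' T hT'
        have h2 := hF S hS' (insert e T) hTi
        have h3 := hF (insert e S) hSi T hT'
        have h4 := hF (insert e S) hSi (insert e T) hTi
        rw [Finset.union_insert, Finset.inter_insert_of_notMem heS] at h2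
        rw [Finset.insert_union, Finset.insert_inter_of_notMem heT] at h3
        rw [← Finset.insert_union_distrib, ← Finset.insert_inter_distrib] at h4
        grind)
      (fun S hS T hT => by
        have hS' := hS.trans (Finset.subset_insert e V)
        have hT' := hT.trans (Finset.subset_insert e V)
        have heS : e ∉ S := fun h => he (hS h)
        have heT : e ∉ T := fun h => he (hT h)
        have hSi := Finset.insert_subset_insert e hS
        have hTi := Finset.insert_subset_insert e hT
        have h1 := hG S hS' T hT'
        have h2 := hG S hS' (insert e T) hTi
        have h3 := hG (insert e S) hSi T hT'
        have h4 := hG (insert e S) hSi (insert e T) hTi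
        rw [Finset.union_insert, Finset.inter_insert_of_notMem heS] at h2
        rw [Finset.insert_union, Finset.insert_inter_of_notMem heT] at h3
        rw [← Finset.insert_union_distrib, ← Finset.insert_inter_distrib] at h4
        grind)
      (fun S hS => by
        have h1 := hGF S (hS.trans (Finset.subset_insert e V))
        have h2 := hGF (insert e S) (Finset.insert_subset_insert e hS)
        have h3 := hylow S hS
        have h4 := hyup S hS
        exact max_le (le_min h1 (by linarith)) (le_min (by linarith) (by linarith)))
    refine ⟨Function.update x e y, fun S hS => ?_⟩
    by_cases heS : e ∈ S
    · have hsub : S.erase e ⊆ V := Finset.subset_insert_iff.1 hS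
      obtain ⟨h1, h2⟩ := hx _ hsub
      simp only [Finset.insert_erase heS] at h1 h2
      rw [← Finset.add_sum_erase S _ heS, Function.update_self,
        Finset.sum_update_of_notMem (Finset.notMem_erase e S)]
      have := (le_max_right _ _).trans h1
      have := h2.trans (min_le_right _ _)
      constructor <;> linarith
    · obtain ⟨h1, h2⟩ := hx S ((Finset.subset_insert_iff_of_notMem heS).1 hS)
      rw [Finset.sum_update_of_notMem heS]
      exact ⟨(le_max_left _ _).trans h1, h2.trans (min_le_left _ _)⟩

/-- The monotone hull of a supermodular function is supermodular. -/
lemma sup'_powerset_supermodular {ι : Type} [DecidableEq ι] {G : Finset ι → ℝ}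
    (hG : ∀ S T, G S + G T ≤ G (S ∪ T) + G (S ∩ T)) (S T : Finset ι) :
    S.powerset.sup' ⟨∅, Finset.empty_mem_powerset S⟩ G +
        T.powerset.sup' ⟨∅, Finset.empty_mem_powerset T⟩ G ≤
      (S ∪ T).powerset.sup' ⟨∅, Finset.empty_mem_powerset _⟩ G +
        (S ∩ T).powerset.sup' ⟨∅, Finset.empty_mem_powerset _⟩ G := by
  obtain ⟨A, hA, hAeq⟩ := Finset.exists_mem_eq_sup' ⟨∅, Finset.empty_mem_powerset S⟩ G
  obtain ⟨B, hB, hBeq⟩ := Finset.exists_mem_eq_sup' ⟨∅, Finset.empty_mem_powerset T⟩ G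
  rw [Finset.mem_powerset] at hA hB
  rw [hAeq, hBeq]
  exact (hG A B).trans (add_le_add
    (Finset.le_sup' G (Finset.mem_powerset.2 (Finset.union_subset_union hA hB)))
    (Finset.le_sup' G (Finset.mem_powerset.2 (Finset.inter_subset_inter hA hB))))

theorem stmt0 {K : ℕ} (hK : 1 ≤ K) {Ω : Type} [Fintype Ω]
    {𝒳 : Fin K → Type} [∀ k, Fintype (𝒳 k)] {𝒴 𝒵 : Type} [Fintype 𝒴] [Fintype 𝒵]
    (p : Ω → ℝ) (hp : IsPMF p)
    (X : ∀ k, Ω → 𝒳 k) (Y : Ω → 𝒴) (Z : Ω → 𝒵) (hind : MutIndep p X)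
    (K' : Finset (Fin K))
    (hcond : ∀ S ⊆ K',
      0 ≤ IcondMut p (tup X S) Y (tup X (Finset.univ \ S)) -
            IcondMut p (tup X S) Z (tup X (Finset.univ \ K')))
    (Rs Ro : Fin K → ℝ) (hRs : ∀ k, 0 ≤ Rs k) (hRo : ∀ k, 0 ≤ Ro k)
    (hRs0 : ∀ k ∈ Finset.univ \ K', Rs k = 0)
    (hrate : ∀ S ⊆ K', ∀ S' ⊆ S, ∀ T ⊆ Finset.univ \ K',
      ∑ k ∈ S, Rs k + ∑ k ∈ S \ S', Ro k + ∑ k ∈ T, Ro k ≤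
        IcondMut p (tup X (S ∪ T)) Y (tup X (Finset.univ \ (S ∪ T))) -
          IcondMut p (tup X S') Z (tup X (Finset.univ \ K'))) :
    ∃ Ra : Fin K → ℝ,
      (∀ k ∈ K', 0 ≤ Ra k) ∧
      (∀ S ⊆ K', ∀ T ⊆ Finset.univ \ K',
        ∑ k ∈ S, (Rs k + Ro k + Ra k) + ∑ k ∈ T, Ro k ≤
          IcondMut p (tup X (S ∪ T)) Y (tup X (Finset.univ \ (S ∪ T)))) ∧
      (∀ S ⊆ K',
        IcondMut p (tup X S) Z (tup X (Finset.univ \ K')) ≤ ∑ k ∈ S, (Ro k + Ra k)) := by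
  set f : Finset (Fin K) → ℝ := fun U => IcondMut p (tup X U) Y (tup X (Finset.univ \ U)) with hf
  set g : Finset (Fin K) → ℝ := fun S => IcondMut p (tup X S) Z (tup X (Finset.univ \ K')) with hg
  set G : Finset (Fin K) → ℝ := fun S => g S - ∑ k ∈ S, Ro k with hGdef
  have hGsuper : ∀ S T, G S + G T ≤ G (S ∪ T) + G (S ∩ T) := fun S T => by
    have h1 := hind.IcondMut_tup_supermodular hp Z (Finset.univ \ K') S T
    have h2 := Finset.sum_union_inter (s₁ := S) (s₂ := T) (f := Ro)
    simp only [hGdef, hg]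
    linarith
  have hG0 : G ∅ = 0 := by simp [hGdef, hg, IcondMut_tup_empty]
  set hull : Finset (Fin K) → ℝ :=
    fun S => S.powerset.sup' ⟨∅, Finset.empty_mem_powerset S⟩ G with hhull
  have hle_hull : ∀ S, ∀ A ⊆ S, G A ≤ hull S := fun S A hA =>
    Finset.le_sup' G (Finset.mem_powerset.2 hA)
  have hhull_nonneg : ∀ S, 0 ≤ hull S := fun S =>
    hG0.symm.le.trans (hle_hull S ∅ (Finset.empty_subset S))
  obtain ⟨x, hx⟩ := exists_sum_between_of_supermodular_of_submodular Finset.univ f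
    (fun U => hull (U ∩ K') + ∑ k ∈ U, (Rs k + Ro k))
    (by simp only [hf, IcondMut_tup_empty])
    (by simp [hhull, hG0])
    (fun S _ T _ => hind.IcondMut_tup_compl_submodular hp Y S T)
    (fun S _ T _ => by
      have h1 := sup'_powerset_supermodular hGsuper (S ∩ K') (T ∩ K')
      rw [← Finset.union_inter_distrib_right, ← Finset.inter_inter_distrib_right] at h1
      have h2 := Finset.sum_union_inter (s₁ := S) (s₂ := T) (f := fun k => Rs k + Ro k)
      simp only [hhull]
      linarith)
    (fun U _ => by
      rw [← le_sub_iff_add_le]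
      refine Finset.sup'_le _ _ fun A hA => ?_
      rw [Finset.mem_powerset] at hA
      have hT : U \ K' ⊆ Finset.univ \ K' := Finset.sdiff_subset_sdiff (Finset.subset_univ U) le_rfl
      have h := hrate (U ∩ K') Finset.inter_subset_right A hA (U \ K') hT
      rw [Finset.union_comm (U ∩ K'), Finset.sdiff_union_inter] at h
      have h1 := Finset.sum_sdiff (f := Ro) hA
      have h2 := Finset.sum_inter_add_sum_sdiff U K' Ro
      have h3 := Finset.sum_inter_add_sum_sdiff U K' Rs
      have h4 := Finset.sum_eq_zero fun k hk => hRs0 k (hT hk)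
      rw [Finset.sum_add_distrib]
      simp only [hGdef, hf, hg]
      linarith)
  have hlow : ∀ k, Rs k + Ro k ≤ x k := fun k => by
    have h := (hx {k} (Finset.subset_univ _)).1
    have h' := hhull_nonneg ({k} ∩ K')
    simp only [Finset.sum_singleton] at h
    linarith
  refine ⟨fun k => x k - Rs k - Ro k, fun k _ => by linarith [hlow k], fun S hS T hT => ?_,
    fun S hS => ?_⟩
  · have hdisj : Disjoint S T := Finset.disjoint_of_subset_left hS
      (Finset.disjoint_of_subset_right hT Finset.disjoint_sdiff)
    have h := (hx (S ∪ T) (Finset.subset_univ _)).2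
    rw [Finset.sum_union hdisj] at h
    have h1 : ∑ k ∈ T, Ro k ≤ ∑ k ∈ T, x k :=
      Finset.sum_le_sum fun k _ => by linarith [hlow k, hRs k]
    have h2 : ∑ k ∈ S, (Rs k + Ro k + (x k - Rs k - Ro k)) = ∑ k ∈ S, x k :=
      Finset.sum_congr rfl fun k _ => by ring
    rw [h2]
    exact (add_le_add_right h1 _).trans h
  · have h := (hx S (Finset.subset_univ _)).1
    have h1 := hle_hull (S ∩ K') S (Finset.subset_inter le_rfl hS)
    simp only [hGdef, hg] at h1
    simp only [Finset.sum_add_distrib, Finset.sum_sub_distrib] at h ⊢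
    linarith
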